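/- arXiv:2405.03735 — 2 statements merged into one kernel-verified Lean document; each statement's English description precedes it below -/
import Mathlib

section
/- Let G = (N, v) be a characteristic function game with |N| = n ≥ 2. Then the Shapley Value and the Exchange Value order the agents in the same way: for all agents i, j ∈ N, EV_i(G) ≥ EV_j(G) if and only if SV_i(G) ≥ SV_j(G). -/
open Finset

/-- The set of all permutations (encoded as lists) of the elements of a finset `s`.
For a nodup base list this is exactly the set `Π_s` of orderings of `s`. -/
noncomputable def permsOf {α : Type*} [DecidableEq α] (s : Finset α) : Finset (List α) :=
  s.toList.permutations.toFinset

/-- The Shapley Value of agent `i` in the characteristic function game on the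
(full, finite) agent set `α` with characteristic function `v`:
`SV_i = (1/n!) ∑_{m=0}^{n-1} ∑_{π ∈ Π_{N∖{i}}} (v (S_π(m) ∪ {i}) - v (S_π(m)))`,
where `S_π(m)` is the set of the first `m` entries of `π`. -/
noncomputable def ShapleyValue {α : Type*} [Fintype α] [DecidableEq α]
    (v : Finset α → ℝ) (i : α) : ℝ :=
  (((Fintype.card α).factorial : ℝ))⁻¹ *
    ∑ π ∈ permsOf (Finset.univ.erase i), ∑ m ∈ Finset.range (Fintype.card α),
      (v (insert i (π.take m).toFinset) - v (π.take m).toFinset)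

/-- The Exchange Value of agent `i`:
`EV_i = (1/((n-1)!·(n-1))) ∑_{m=1}^{n-1} ∑_{π ∈ Π_{N∖{i}}} (v (S_π(m-1) ∪ {i}) - v (S_π(m)))`. -/
noncomputable def ExchangeValue {α : Type*} [Fintype α] [DecidableEq α]
    (v : Finset α → ℝ) (i : α) : ℝ :=
  ((((Fintype.card α - 1).factorial * (Fintype.card α - 1) : ℕ) : ℝ))⁻¹ *
    ∑ π ∈ permsOf (Finset.univ.erase i), ∑ m ∈ Finset.Icc 1 (Fintype.card α - 1),
      (v (insert i (π.take (m - 1)).toFinset) - v (π.take m).toFinset)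

theorem card_permsOf {α : Type*} [DecidableEq α] (s : Finset α) :
    (permsOf s).card = s.card.factorial := by
  rw [permsOf, List.toFinset_card_of_nodup (List.nodup_permutations _ s.nodup_toList),
    List.length_permutations, Finset.length_toList]

theorem perm_toList_of_mem_permsOf {α : Type*} [DecidableEq α] {s : Finset α} {π : List α}
    (hπ : π ∈ permsOf s) : π.Perm s.toList := by
  rwa [permsOf, List.mem_toFinset, List.mem_permutations] at hπ

theorem toFinset_of_mem_permsOf {α : Type*} [DecidableEq α] {s : Finset α} {π : List α}
    (hπ : π ∈ permsOf s) : π.toFinset = s := by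
  rw [List.toFinset_eq_of_perm _ _ (perm_toList_of_mem_permsOf hπ), Finset.toList_toFinset]

theorem length_of_mem_permsOf {α : Type*} [DecidableEq α] {s : Finset α} {π : List α}
    (hπ : π ∈ permsOf s) : π.length = s.card := by
  rw [(perm_toList_of_mem_permsOf hπ).length_eq, Finset.length_toList]

/-- Along an ordering of the other agents, the marginal contributions of `i` exceed its exchange
contributions by the value of the grand coalition minus that of the empty one. -/
theorem sum_marginal_eq_sum_exchange_add {α : Type*} [Fintype α] [DecidableEq α]
    (v : Finset α → ℝ) (i : α) {π : List α} (hπ : π ∈ permsOf (Finset.univ.erase i)) :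
    ∑ m ∈ Finset.range (Fintype.card α),
        (v (insert i (π.take m).toFinset) - v (π.take m).toFinset) =
      ∑ m ∈ Finset.Icc 1 (Fintype.card α - 1),
        (v (insert i (π.take (m - 1)).toFinset) - v (π.take m).toFinset) +
      (v Finset.univ - v ∅) := by
  have hlen : π.length = Fintype.card α - 1 := by
    rw [length_of_mem_permsOf hπ, Finset.card_erase_of_mem (Finset.mem_univ i), Finset.card_univ]
  have hcard : Fintype.card α = Fintype.card α - 1 + 1 :=
    (Nat.succ_pred_eq_of_pos (Fintype.card_pos_iff.2 ⟨i⟩)).symm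
  have hall : insert i (π.take (Fintype.card α - 1)).toFinset = Finset.univ := by
    rw [← hlen, List.take_length, toFinset_of_mem_permsOf hπ,
      Finset.insert_erase (Finset.mem_univ i)]
  have hIcc : Finset.Icc 1 (Fintype.card α - 1) = Finset.Ico 1 (Fintype.card α - 1 + 1) := by
    ext; simp only [Finset.mem_Icc, Finset.mem_Ico]; lia
  rw [hIcc, Finset.sum_Ico_eq_sum_range, hcard]
  simp only [Nat.add_sub_cancel, Nat.add_sub_cancel_left, Finset.sum_sub_distrib]
  rw [Finset.sum_range_succ, hall,
    Finset.sum_range_succ' (fun m => v (π.take m).toFinset)]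
  simp only [add_comm 1, List.take_zero, List.toFinset_nil]
  ring

/-- The Shapley Value is a positive affine function of the Exchange Value. -/
theorem factorial_mul_shapleyValue {α : Type*} [Fintype α] [DecidableEq α]
    (hn : 2 ≤ Fintype.card α) (v : Finset α → ℝ) (i : α) :
    ((Fintype.card α).factorial : ℝ) * ShapleyValue v i =
      (((Fintype.card α - 1).factorial * (Fintype.card α - 1) : ℕ) : ℝ) * ExchangeValue v i +
        ((Fintype.card α - 1).factorial : ℝ) * (v Finset.univ - v ∅) := by
  have hS : ((Fintype.card α).factorial : ℝ) ≠ 0 :=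
    Nat.cast_ne_zero.2 (Nat.factorial_ne_zero _)
  have hE : (((Fintype.card α - 1).factorial * (Fintype.card α - 1) : ℕ) : ℝ) ≠ 0 :=
    Nat.cast_ne_zero.2 (mul_ne_zero (Nat.factorial_ne_zero _) (by lia))
  rw [ShapleyValue, ExchangeValue, mul_inv_cancel_left₀ hS, mul_inv_cancel_left₀ hE,
    Finset.sum_congr rfl fun π hπ => sum_marginal_eq_sum_exchange_add v i hπ,
    Finset.sum_add_distrib, Finset.sum_const, card_permsOf,
    Finset.card_erase_of_mem (Finset.mem_univ i), Finset.card_univ, nsmul_eq_mul]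

/-- The Shapley Value and the Exchange Value order the agents in the same way:
`EV_i(G) ≥ EV_j(G)` iff `SV_i(G) ≥ SV_j(G)`, for `n ≥ 2`. -/
theorem exchangeValue_ge_iff_shapleyValue_ge
    {α : Type*} [Fintype α] [DecidableEq α]
    (hn : 2 ≤ Fintype.card α) (v : Finset α → ℝ) (hv : v ∅ = 0) (i j : α) :
    ExchangeValue v i ≥ ExchangeValue v j ↔ ShapleyValue v i ≥ ShapleyValue v j := by
  have hS : (0 : ℝ) < ((Fintype.card α).factorial : ℝ) :=
    Nat.cast_pos.2 (Nat.factorial_pos _)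
  have hE : (0 : ℝ) < (((Fintype.card α - 1).factorial * (Fintype.card α - 1) : ℕ) : ℝ) :=
    Nat.cast_pos.2 (Nat.mul_pos (Nat.factorial_pos _) (by lia))
  rw [ge_iff_le, ge_iff_le, ← mul_le_mul_iff_right₀ (b := ShapleyValue v j) hS, factorial_mul_shapleyValue hn,
    factorial_mul_shapleyValue hn, add_le_add_iff_right, mul_le_mul_iff_right₀ hE]
end

section
/- The Exchange Value satisfies the symmetry axiom: if G = (N, v) is a characteristic function game with |N| = n ≥ 2 and i, j ∈ N are distinct agents such that v(C ∪ {i}) = v(C ∪ {j}) for all C ⊆ N∖{i, j}, then EV_i(G) = EV_j(G). -/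
open Finset

theorem mem_permsOf {α : Type*} [DecidableEq α] {s : Finset α} {l : List α} :
    l ∈ permsOf s ↔ l.Nodup ∧ l.toFinset = s := by
  rw [permsOf, List.mem_toFinset, List.mem_permutations]
  constructor
  · intro h
    exact ⟨h.nodup_iff.2 s.nodup_toList, by rw [List.toFinset_eq_of_perm _ _ h, s.toList_toFinset]⟩
  · rintro ⟨h, rfl⟩
    exact (List.toFinset_toList h).symm

theorem map_mem_permsOf {α β : Type*} [DecidableEq α] [DecidableEq β] (f : α ↪ β)
    {s : Finset α} {l : List α} (h : l ∈ permsOf s) : l.map f ∈ permsOf (s.map f) := by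
  rw [mem_permsOf] at h ⊢
  refine ⟨h.1.map f.injective, ?_⟩
  rw [← h.2]
  ext x
  simp

/-- The Exchange Value is invariant under relabelling the agents by a permutation which
preserves the characteristic function. -/
theorem exchangeValue_apply_eq_of_invariant {α : Type*} [Fintype α] [DecidableEq α]
    (v : Finset α → ℝ) (σ : Equiv.Perm α) (hσ : ∀ S : Finset α, v (S.image σ) = v S) (i : α) :
    ExchangeValue v (σ i) = ExchangeValue v i := by
  have herase (τ : Equiv.Perm α) (k : α) :
      (univ.erase k).map τ.toEmbedding = univ.erase (τ k) := by
    rw [map_erase, map_univ_equiv]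
    rfl
  unfold ExchangeValue
  congr 1
  refine (sum_bij' (fun π _ ↦ π.map σ) (fun π _ ↦ π.map σ.symm) ?_ ?_ ?_ ?_ ?_).symm
  · intro π hπ
    rw [← herase]
    exact map_mem_permsOf σ.toEmbedding hπ
  · intro π hπ
    have h := map_mem_permsOf σ.symm.toEmbedding hπ
    rwa [herase, σ.symm_apply_apply] at h
  · intro π _
    simp
  · intro π _
    simp
  · intro π _
    refine sum_congr rfl fun m _ ↦ ?_
    have himage (k : ℕ) : ((π.map σ).take k).toFinset = (π.take k).toFinset.image σ := by
      ext x
      simp [← List.map_take]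
    rw [himage, himage, ← image_insert, hσ, hσ]

/-- A characteristic function that does not distinguish `i` from `j` is invariant under
swapping them. -/
theorem apply_image_swap {α β : Type*} [DecidableEq α] (v : Finset α → β) {i j : α}
    (hsym : ∀ C : Finset α, i ∉ C → j ∉ C → v (insert i C) = v (insert j C)) (S : Finset α) :
    v (S.image (Equiv.swap i j)) = v S := by
  have hmem (x : α) : x ∈ S.image (Equiv.swap i j) ↔ Equiv.swap i j x ∈ S := by
    simp [Equiv.swap_apply_eq_iff]
  by_cases hi : i ∈ S <;> by_cases hj : j ∈ S
  · congr 1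
    ext x
    rw [hmem, Equiv.swap_apply_def]
    grind
  · have h : S.image (Equiv.swap i j) = insert j (S.erase i) := by
      ext x
      rw [hmem, Equiv.swap_apply_def]
      grind
    rw [h, ← hsym _ (by simp) (by simp [hj]), insert_erase hi]
  · have h : S.image (Equiv.swap i j) = insert i (S.erase j) := by
      ext x
      rw [hmem, Equiv.swap_apply_def]
      grind
    rw [h, hsym _ (by simp [hi]) (by simp), insert_erase hj]
  · congr 1
    ext x
    rw [hmem, Equiv.swap_apply_def]
    grind

/-- The Exchange Value satisfies the symmetry axiom: if `i ≠ j` and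
`v (C ∪ {i}) = v (C ∪ {j})` for all `C ⊆ N ∖ {i, j}`, then `EV_i(G) = EV_j(G)`. -/
theorem exchangeValue_symmetry
    {α : Type*} [Fintype α] [DecidableEq α]
    (hn : 2 ≤ Fintype.card α) (v : Finset α → ℝ) (hv : v ∅ = 0) (i j : α)
    (hij : i ≠ j)
    (hsym : ∀ C : Finset α, i ∉ C → j ∉ C → v (insert i C) = v (insert j C)) :
    ExchangeValue v i = ExchangeValue v j := by
  have h := exchangeValue_apply_eq_of_invariant v (Equiv.swap i j) (apply_image_swap v hsym) j
  rwa [Equiv.swap_apply_right] at h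
end
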